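/- Let N, M ≥ 0 be integers and g > 0 a real number. Define the complex-valued function F on the region U by F(x,y) = Ψ₀(x,y;g) · (∑_{j=1}^N e^{i x_j} − (1/g)∑_{k=1}^M e^{i y_k}). Then F is a pointwise eigenfunction of the deformed Calogero–Sutherland operator: H_{N,M}(x,y;g) F = (1 + g(N−1) − M + (g²/12)·[(N − M/g)³ − (N − M/g³)]) · F on U. -/

import Mathlib

open Finset

/-- Partial derivative in the `j`-th coordinate of a function `(Fin n → ℝ) → ℂ`. -/
noncomputable def pd {n : ℕ} (j : Fin n) (f : (Fin n → ℝ) → ℂ) : (Fin n → ℝ) → ℂ :=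
  fun x => deriv (fun t : ℝ => f (Function.update x j t)) (x j)

/-- The deformed Calogero–Sutherland operator `H_{N,M}(x,y;g)`, acting on functions of
`(x_1,…,x_N,y_1,…,y_M)` encoded as `u : Fin (N+M) → ℝ` with `x_j = u (Fin.castAdd M j)`
and `y_k = u (Fin.natAdd N k)`. -/
noncomputable def HNM (N M : ℕ) (g : ℝ) (f : (Fin (N + M) → ℝ) → ℂ) :
    (Fin (N + M) → ℝ) → ℂ := fun u =>
  -(∑ j : Fin N, pd (Fin.castAdd M j) (pd (Fin.castAdd M j) f) u)
    + (g : ℂ) * ∑ k : Fin M, pd (Fin.natAdd N k) (pd (Fin.natAdd N k) f) u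
    + (((∑ j : Fin N, ∑ j' : Fin N, if j < j' then
            g * (g - 1) / (2 * Real.sin ((u (Fin.castAdd M j) - u (Fin.castAdd M j')) / 2) ^ 2)
          else 0)
        + (∑ k : Fin M, ∑ k' : Fin M, if k < k' then
            ((g - 1) / g) / (2 * Real.sin ((u (Fin.natAdd N k) - u (Fin.natAdd N k')) / 2) ^ 2)
          else 0)
        + ∑ j : Fin N, ∑ k : Fin M,
            (1 - g) / (2 * Real.sin ((u (Fin.castAdd M j) - u (Fin.natAdd N k)) / 2) ^ 2) : ℝ) : ℂ)
      * f u

/-- The dCS ground state `Ψ₀(x,y;g)` (with real powers). -/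
noncomputable def Psi0 (N M : ℕ) (g : ℝ) (u : Fin (N + M) → ℝ) : ℝ :=
  ((∏ j : Fin N, ∏ j' : Fin N, if j < j' then
      Real.sin ((u (Fin.castAdd M j) - u (Fin.castAdd M j')) / 2) else 1) ^ g)
    * ((∏ k : Fin M, ∏ k' : Fin M, if k < k' then
        Real.sin ((u (Fin.natAdd N k) - u (Fin.natAdd N k')) / 2) else 1) ^ (1 / g))
    / ∏ j : Fin N, ∏ k : Fin M, Real.sin ((u (Fin.castAdd M j) - u (Fin.natAdd N k)) / 2)

/-- The open region `U = {π > x_1 > ⋯ > x_N > y_1 > ⋯ > y_M > −π}`. -/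
def regionU (N M : ℕ) : Set (Fin (N + M) → ℝ) :=
  {u | (∀ i, u i ∈ Set.Ioo (-Real.pi) Real.pi) ∧ StrictAnti u}

/-- The half-angle cotangent, with value `0` on the diagonal. -/
noncomputable def halfCot {n : ℕ} (v : Fin n → ℝ) (i j : Fin n) : ℝ :=
  Real.cos ((v i - v j) / 2) / Real.sin ((v i - v j) / 2)

/-- The squared half-angle cosecant, with value `0` on the diagonal. -/
noncomputable def halfCscSq {n : ℕ} (v : Fin n → ℝ) (i j : Fin n) : ℝ :=
  1 / Real.sin ((v i - v j) / 2) ^ 2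

/-- The logarithm of `∏_{i<j} sin((v_i - v_j)/2) ^ (g m_i m_j)`, as a symmetric double sum. -/
noncomputable def logGround {n : ℕ} (g : ℝ) (m : Fin n → ℝ) (v : Fin n → ℝ) : ℝ :=
  ∑ i, ∑ j, g * m i * m j / 2 * Real.log (Real.sin ((v i - v j) / 2))

/-- The partial derivatives of `logGround`. -/
noncomputable def gradLogGround {n : ℕ} (g : ℝ) (m : Fin n → ℝ) (i : Fin n) (v : Fin n → ℝ) : ℝ :=
  g * m i / 2 * ∑ j, m j * halfCot v i j

/-- The weighted power sum `∑_i m_i e^{i v_i}`. -/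
noncomputable def expSum {n : ℕ} (m : Fin n → ℝ) (v : Fin n → ℝ) : ℂ :=
  ∑ i, (m i : ℂ) * Complex.exp (Complex.I * (v i : ℂ))

/-- Configurations whose half-differences have nonzero sine. -/
def Regular {n : ℕ} (v : Fin n → ℝ) : Prop :=
  ∀ i j, i ≠ j → Real.sin ((v i - v j) / 2) ≠ 0

section Trigonometry

variable {n : ℕ} {v : Fin n → ℝ}

lemma sin_half_sub_comm (v : Fin n → ℝ) (i j : Fin n) :
    Real.sin ((v i - v j) / 2) = -Real.sin ((v j - v i) / 2) := by
  rw [← Real.sin_neg]; congr 1; ring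

lemma cos_half_sub_comm (v : Fin n → ℝ) (i j : Fin n) :
    Real.cos ((v i - v j) / 2) = Real.cos ((v j - v i) / 2) := by
  rw [← Real.cos_neg]; congr 1; ring

lemma halfCot_self (v : Fin n → ℝ) (i : Fin n) : halfCot v i i = 0 := by simp [halfCot]

lemma halfCscSq_self (v : Fin n → ℝ) (i : Fin n) : halfCscSq v i i = 0 := by simp [halfCscSq]

lemma halfCot_comm (v : Fin n → ℝ) (i j : Fin n) : halfCot v i j = -halfCot v j i := by
  rw [halfCot, halfCot, sin_half_sub_comm v i j, cos_half_sub_comm v i j, div_neg]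

lemma halfCscSq_comm (v : Fin n → ℝ) (i j : Fin n) : halfCscSq v i j = halfCscSq v j i := by
  rw [halfCscSq, halfCscSq, sin_half_sub_comm v i j, neg_sq]

lemma halfCot_sq (hv : Regular v) {i j : Fin n} (hij : i ≠ j) :
    halfCot v i j ^ 2 = halfCscSq v i j - 1 := by
  have h := hv i j hij
  rw [halfCot, halfCscSq]
  field_simp
  linarith [Real.sin_sq_add_cos_sq ((v i - v j) / 2)]

lemma halfCot_cyclic (hv : Regular v) {i j k : Fin n} (hij : i ≠ j) (hik : i ≠ k) (hjk : j ≠ k) :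
    halfCot v i j * halfCot v i k + halfCot v j i * halfCot v j k
      + halfCot v k i * halfCot v k j = -1 := by
  rw [halfCot_comm v j i, halfCot_comm v k i, halfCot_comm v k j]
  have h1 := hv i j hij
  have h2 := hv i k hik
  have h3 := hv j k hjk
  have e : (v i - v k) / 2 = (v i - v j) / 2 + (v j - v k) / 2 := by ring
  simp only [halfCot]
  rw [e] at h2 ⊢
  generalize (v i - v j) / 2 = a at *
  generalize (v j - v k) / 2 = b at *
  field_simp
  rw [Real.sin_add, Real.cos_add]
  ring

lemma halfCot_three_term (hv : Regular v) (i j k : Fin n) :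
    halfCot v i j * halfCot v i k + halfCot v j i * halfCot v j k
      + halfCot v k i * halfCot v k j
    = -1 + (if i = j then halfCscSq v i k else 0) + (if i = k then halfCscSq v i j else 0)
      + (if j = k then halfCscSq v i j else 0) + (if i = j then if i = k then 1 else 0 else 0) := by
  by_cases hij : i = j
  · subst hij
    by_cases hik : i = k
    · subst hik
      simp [halfCot_self, halfCscSq_self]
    · have := halfCot_sq hv hik
      rw [halfCot_comm v k i]
      simp [halfCot_self, hik]
      linarith
  · by_cases hik : i = k
    · subst hik
      have := halfCot_sq hv hij
      rw [halfCot_comm v j i]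
      simp [halfCot_self, hij, Ne.symm hij]
      linarith
    · by_cases hjk : j = k
      · subst hjk
        have := halfCot_sq hv hij
        rw [halfCot_comm v j i]
        simp [halfCot_self, hij]
        linarith
      · simp [hij, hik, hjk, halfCot_cyclic hv hij hik hjk]

lemma halfCot_mul_exp_sub_exp (hv : Regular v) (i j : Fin n) :
    (halfCot v i j : ℂ) * (Complex.exp (Complex.I * (v i : ℂ)) - Complex.exp (Complex.I * (v j : ℂ)))
      = Complex.I * (Complex.exp (Complex.I * (v i : ℂ)) + Complex.exp (Complex.I * (v j : ℂ)))
        - (if i = j then 2 * Complex.I * Complex.exp (Complex.I * (v i : ℂ)) else 0) := by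
  by_cases hij : i = j
  · subst hij; simp; ring
  have h := hv i j hij
  have h' : Complex.sin (((v i : ℂ) - v j) / 2) ≠ 0 := by
    have := Complex.ofReal_ne_zero.2 h
    push_cast at this
    exact this
  simp only [hij, if_false, sub_zero, halfCot]
  push_cast
  have e1 : Complex.I * (v i : ℂ)
      = Complex.I * ((v i + v j) / 2) + ((v i - v j) / 2) * Complex.I := by ring
  have e2 : Complex.I * (v j : ℂ)
      = Complex.I * ((v i + v j) / 2) + (-((v i - v j) / 2)) * Complex.I := by ring
  rw [e1, e2, Complex.exp_add, Complex.exp_add, Complex.exp_mul_I, Complex.exp_mul_I,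
    Complex.cos_neg, Complex.sin_neg]
  field_simp
  ring

end Trigonometry

section Algebra

variable {n : ℕ} {v : Fin n → ℝ}

lemma sum_halfCot_mul_halfCot (hv : Regular v) (m : Fin n → ℝ) :
    3 * ∑ i, m i * (∑ j, m j * halfCot v i j) ^ 2
      = 3 * ∑ i, ∑ j, m i * m j ^ 2 * halfCscSq v i j + ∑ i, m i ^ 3 - (∑ i, m i) ^ 3 := by
  have expand : ∑ i, m i * (∑ j, m j * halfCot v i j) ^ 2
      = ∑ i, ∑ j, ∑ k, m i * m j * m k * (halfCot v i j * halfCot v i k) := by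
    refine sum_congr rfl fun i _ => ?_
    rw [sq, sum_mul_sum, mul_sum]
    refine sum_congr rfl fun j _ => ?_
    rw [mul_sum]
    exact sum_congr rfl fun k _ => by ring
  have second : ∑ i, ∑ j, ∑ k, m i * m j * m k * (halfCot v i j * halfCot v i k)
      = ∑ i, ∑ j, ∑ k, m i * m j * m k * (halfCot v j i * halfCot v j k) := by
    rw [sum_comm]
    exact sum_congr rfl fun i _ => sum_congr rfl fun j _ => sum_congr rfl fun k _ => by ring
  have third : ∑ i, ∑ j, ∑ k, m i * m j * m k * (halfCot v j i * halfCot v j k)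
      = ∑ i, ∑ j, ∑ k, m i * m j * m k * (halfCot v k i * halfCot v k j) := by
    refine sum_congr rfl fun i _ => ?_
    rw [sum_comm]
    exact sum_congr rfl fun j _ => sum_congr rfl fun k _ => by ring
  have cube : (∑ i, m i) ^ 3 = ∑ i, ∑ j, ∑ k, m i * m j * m k := by
    rw [pow_succ, sq, sum_mul_sum, sum_mul]
    refine sum_congr rfl fun i _ => ?_
    rw [sum_mul]
    exact sum_congr rfl fun j _ => by rw [mul_sum]
  have key : 3 * ∑ i, m i * (∑ j, m j * halfCot v i j) ^ 2
      = ∑ i, ∑ j, ∑ k, m i * m j * m k *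
        (-1 + (if i = j then halfCscSq v i k else 0) + (if i = k then halfCscSq v i j else 0)
      + (if j = k then halfCscSq v i j else 0)
      + (if i = j then if i = k then 1 else 0 else 0)) := by
    calc _ = ∑ i, ∑ j, ∑ k, m i * m j * m k * (halfCot v i j * halfCot v i k)
          + ∑ i, ∑ j, ∑ k, m i * m j * m k * (halfCot v j i * halfCot v j k)
          + ∑ i, ∑ j, ∑ k, m i * m j * m k * (halfCot v k i * halfCot v k j) := by
            rw [← third, ← second, expand]; ring
      _ = _ := by
        simp only [← sum_add_distrib, ← mul_add, halfCot_three_term hv]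
  have flip : ∑ i, ∑ j, m i * m i * m j * halfCscSq v i j
      = ∑ i, ∑ j, m i * m j ^ 2 * halfCscSq v i j := by
    rw [sum_comm]
    exact sum_congr rfl fun i _ => sum_congr rfl fun j _ => by rw [halfCscSq_comm v j i]; ring
  have flip' : ∑ i, ∑ j, m i * m j * m i * halfCscSq v i j
      = ∑ i, ∑ j, m i * m j ^ 2 * halfCscSq v i j := by
    rw [← flip]
    exact sum_congr rfl fun i _ => sum_congr rfl fun j _ => by ring
  rw [key, cube]
  simp only [mul_add, sum_add_distrib, mul_ite, mul_zero, sum_ite_eq, mem_univ, if_true,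
    mul_neg, mul_one, sum_neg_distrib]
  have diag : ∑ i, ∑ j, ∑ k, (if i = j then m i * m j * m k * halfCscSq v i k else 0)
      = ∑ i, ∑ j, m i * m i * m j * halfCscSq v i j := by
    refine sum_congr rfl fun i _ => ?_
    rw [sum_comm]
    simp
  have diag' : ∑ i, ∑ j, ∑ k, (if i = j then if i = k then m i * m j * m k else 0 else 0)
      = ∑ i, m i ^ 3 := by
    refine sum_congr rfl fun i _ => ?_
    rw [sum_comm]
    simp
    ring
  have diag'' : ∑ i, ∑ j, m i * m j * m j * halfCscSq v i j
      = ∑ i, ∑ j, m i * m j ^ 2 * halfCscSq v i j :=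
    sum_congr rfl fun i _ => sum_congr rfl fun j _ => by ring
  rw [diag, diag', flip, flip', diag'']
  ring

lemma sum_halfCot_mul_exp (hv : Regular v) (m : Fin n → ℝ) :
    ∑ i, ∑ j, (m i * m j * halfCot v i j : ℂ) * Complex.exp (Complex.I * (v i : ℂ))
      = Complex.I * ((∑ i, (m i : ℂ)) * expSum m v
        - ∑ i, (m i : ℂ) ^ 2 * Complex.exp (Complex.I * (v i : ℂ))) := by
  have flip : ∑ i, ∑ j, (m i * m j * halfCot v i j : ℂ) * Complex.exp (Complex.I * (v i : ℂ))
      = ∑ i, ∑ j, -((m i * m j * halfCot v i j : ℂ) * Complex.exp (Complex.I * (v j : ℂ))) := by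
    rw [sum_comm]
    refine sum_congr rfl fun i _ => sum_congr rfl fun j _ => ?_
    rw [halfCot_comm v j i]
    push_cast
    ring
  have double : 2 * ∑ i, ∑ j,
        (m i * m j * halfCot v i j : ℂ) * Complex.exp (Complex.I * (v i : ℂ))
      = ∑ i, ∑ j, (m i * m j : ℂ) *
        (Complex.I * (Complex.exp (Complex.I * (v i : ℂ)) + Complex.exp (Complex.I * (v j : ℂ)))
        - (if i = j then 2 * Complex.I * Complex.exp (Complex.I * (v i : ℂ)) else 0)) := by
    rw [two_mul]
    nth_rewrite 2 [flip]
    simp only [← sum_add_distrib]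
    refine sum_congr rfl fun i _ => sum_congr rfl fun j _ => ?_
    rw [← halfCot_mul_exp_sub_exp hv]
    ring
  have prod₁ : ∑ i, ∑ j, (m i * m j : ℂ) * (Complex.I * Complex.exp (Complex.I * (v j : ℂ)))
      = Complex.I * ((∑ i, (m i : ℂ)) * expSum m v) := by
    rw [expSum, sum_mul_sum, mul_sum]
    refine sum_congr rfl fun i _ => ?_
    rw [mul_sum]
    exact sum_congr rfl fun j _ => by ring
  have prod₂ : ∑ i, ∑ j, (m i * m j : ℂ) * (Complex.I * Complex.exp (Complex.I * (v i : ℂ)))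
      = Complex.I * ((∑ i, (m i : ℂ)) * expSum m v) := by
    rw [← prod₁, sum_comm]
    exact sum_congr rfl fun i _ => sum_congr rfl fun j _ => by ring
  have diag : ∑ i, (m i * m i : ℂ) * (2 * Complex.I * Complex.exp (Complex.I * (v i : ℂ)))
      = 2 * (Complex.I * ∑ i, (m i : ℂ) ^ 2 * Complex.exp (Complex.I * (v i : ℂ))) := by
    rw [mul_sum, mul_sum]
    exact sum_congr rfl fun i _ => by ring
  refine mul_left_cancel₀ (two_ne_zero (α := ℂ)) ?_
  rw [double]
  simp only [mul_sub, mul_add, sum_add_distrib, sum_sub_distrib, mul_ite, mul_zero, sum_ite_eq,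
    mem_univ, if_true]
  rw [prod₁, prod₂, diag]
  ring

end Algebra

section Derivatives

variable {n : ℕ} {v : Fin n → ℝ}

lemma hasDerivAt_update_apply (v : Fin n → ℝ) (i a : Fin n) :
    HasDerivAt (fun t : ℝ => Function.update v i t a) (if a = i then 1 else 0) (v i) := by
  by_cases h : a = i
  · subst h; simpa using hasDerivAt_id' (v a)
  · simpa [Function.update_of_ne h, h] using hasDerivAt_const (v i) (v a)

lemma hasDerivAt_half_sub_update (v : Fin n → ℝ) (i a b : Fin n) :
    HasDerivAt (fun t : ℝ => (Function.update v i t a - Function.update v i t b) / 2)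
      (((if a = i then 1 else 0) - (if b = i then 1 else 0)) / 2) (v i) :=
  ((hasDerivAt_update_apply v i a).sub (hasDerivAt_update_apply v i b)).div_const 2

lemma hasDerivAt_log_sin_update (hv : Regular v) (i a b : Fin n) :
    HasDerivAt (fun t : ℝ =>
        Real.log (Real.sin ((Function.update v i t a - Function.update v i t b) / 2)))
      (halfCot v a b * (((if a = i then 1 else 0) - (if b = i then 1 else 0)) / 2)) (v i) := by
  by_cases h : a = b
  · subst h; simpa using hasDerivAt_const (v i) (0 : ℝ)
  have h1 := (hasDerivAt_half_sub_update v i a b).sin.log (by simpa using hv a b h)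
  refine h1.congr_deriv ?_
  simp only [Function.update_eq_self, halfCot]
  ring

lemma hasDerivAt_logGround (hv : Regular v) (g : ℝ) (m : Fin n → ℝ) (i : Fin n) :
    HasDerivAt (fun t : ℝ => logGround g m (Function.update v i t))
      (gradLogGround g m i v) (v i) := by
  have h := HasDerivAt.fun_sum (u := univ) fun a (_ : a ∈ univ) =>
    HasDerivAt.fun_sum (u := univ) fun b (_ : b ∈ univ) =>
      (hasDerivAt_log_sin_update hv i a b).const_mul (g * m a * m b / 2)
  refine h.congr_deriv ?_
  simp only [sub_div, mul_sub, sum_sub_distrib, ite_div, zero_div, mul_ite, mul_zero,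
    sum_ite_eq', mem_univ, if_true]
  rw [sum_comm]
  simp only [sum_ite_eq', mem_univ, if_true]
  rw [← sum_sub_distrib, gradLogGround, mul_sum]
  refine sum_congr rfl fun j _ => ?_
  rw [halfCot_comm v j i]
  ring

lemma hasDerivAt_halfCot (hv : Regular v) (i j : Fin n) :
    HasDerivAt (fun t : ℝ => halfCot (Function.update v i t) i j)
      (-halfCscSq v i j / 2) (v i) := by
  by_cases h : i = j
  · subst h; simpa [halfCot_self, halfCscSq_self] using hasDerivAt_const (v i) (0 : ℝ)
  have h0 := hv i j h
  have h1 := hasDerivAt_half_sub_update v i i j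
  refine (h1.cos.fun_div h1.sin (by simpa using h0)).congr_deriv ?_
  simp only [Function.update_eq_self, halfCscSq, if_true, Ne.symm h, if_false]
  field_simp
  linarith [Real.sin_sq_add_cos_sq ((v i - v j) / 2)]

lemma hasDerivAt_gradLogGround (hv : Regular v) (g : ℝ) (m : Fin n → ℝ) (i : Fin n) :
    HasDerivAt (fun t : ℝ => gradLogGround g m i (Function.update v i t))
      (-(g * m i / 4 * ∑ j, m j * halfCscSq v i j)) (v i) := by
  have h := (HasDerivAt.fun_sum (u := univ) fun j (_ : j ∈ univ) =>
    (hasDerivAt_halfCot hv i j).const_mul (m j)).const_mul (g * m i / 2)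
  refine h.congr_deriv ?_
  rw [mul_sum, mul_sum, ← sum_neg_distrib]
  exact sum_congr rfl fun j _ => by ring

lemma hasDerivAt_exp_update (v : Fin n → ℝ) (i a : Fin n) :
    HasDerivAt (fun t : ℝ => Complex.exp (Complex.I * (Function.update v i t a : ℂ)))
      (if a = i then Complex.I * Complex.exp (Complex.I * (v a : ℂ)) else 0) (v i) := by
  have h := ((hasDerivAt_update_apply v i a).ofReal_comp.const_mul Complex.I).cexp
  refine h.congr_deriv ?_
  by_cases hai : a = i <;> simp [hai, mul_comm]

lemma hasDerivAt_expSum (v : Fin n → ℝ) (m : Fin n → ℝ) (i : Fin n) :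
    HasDerivAt (fun t : ℝ => expSum m (Function.update v i t))
      (m i * (Complex.I * Complex.exp (Complex.I * (v i : ℂ)))) (v i) := by
  have h := HasDerivAt.fun_sum (u := univ) fun a (_ : a ∈ univ) =>
    (hasDerivAt_exp_update v i a).const_mul (m a : ℂ)
  refine h.congr_deriv ?_
  simp

lemma hasDerivAt_exp_logGround (hv : Regular v) (g : ℝ) (m : Fin n → ℝ) (i : Fin n) :
    HasDerivAt (fun t : ℝ => (Real.exp (logGround g m (Function.update v i t)) : ℂ))
      (Real.exp (logGround g m v) * gradLogGround g m i v) (v i) := by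
  refine (hasDerivAt_logGround hv g m i).exp.ofReal_comp.congr_deriv ?_
  simp

lemma pd_eq_of_hasDerivAt {f : (Fin n → ℝ) → ℂ} {i : Fin n} {d : ℂ}
    (h : HasDerivAt (fun t : ℝ => f (Function.update v i t)) d (v i)) : pd i f v = d :=
  h.deriv

lemma pd_congr_of_isOpen {U : Set (Fin n → ℝ)} (hU : IsOpen U) {f f' : (Fin n → ℝ) → ℂ}
    (hf : ∀ w ∈ U, f w = f' w) (hv : v ∈ U) (i : Fin n) : pd i f v = pd i f' v := by
  refine Filter.EventuallyEq.deriv_eq ?_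
  have hc : ContinuousAt (fun t : ℝ => Function.update v i t) (v i) :=
    (continuous_const.update i continuous_id).continuousAt
  have hmem : U ∈ nhds (Function.update v i (v i)) := by
    rw [Function.update_eq_self]; exact hU.mem_nhds hv
  filter_upwards [hc.preimage_mem_nhds hmem] with t ht using hf _ ht

lemma pd_ground_mul_expSum (hv : Regular v) (g : ℝ) (m : Fin n → ℝ) (i : Fin n) :
    pd i (fun w => (Real.exp (logGround g m w) : ℂ) * expSum m w) v
      = Real.exp (logGround g m v) * (gradLogGround g m i v * expSum m v
        + m i * (Complex.I * Complex.exp (Complex.I * (v i : ℂ)))) := by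
  refine pd_eq_of_hasDerivAt
    (((hasDerivAt_exp_logGround hv g m i).mul (hasDerivAt_expSum v m i)).congr_deriv ?_)
  simp only [Function.update_eq_self]
  ring

lemma pd_pd_ground_mul_expSum {U : Set (Fin n → ℝ)} (hU : IsOpen U)
    (hreg : ∀ w ∈ U, Regular w) (hv : v ∈ U) (g : ℝ) (m : Fin n → ℝ) (i : Fin n) :
    pd i (pd i (fun w => (Real.exp (logGround g m w) : ℂ) * expSum m w)) v
      = Real.exp (logGround g m v) *
        ((gradLogGround g m i v ^ 2 - g * m i / 4 * ∑ j, m j * halfCscSq v i j : ℝ) * expSum m v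
        + (2 * Complex.I * gradLogGround g m i v - 1)
          * (m i * Complex.exp (Complex.I * (v i : ℂ)))) := by
  rw [pd_congr_of_isOpen hU (fun w hw => pd_ground_mul_expSum (hreg w hw) g m i) hv]
  have hr := hreg v hv
  have hexp := hasDerivAt_exp_update v i i
  rw [if_pos rfl] at hexp
  have h := (hasDerivAt_exp_logGround hr g m i).mul
    (((hasDerivAt_gradLogGround hr g m i).ofReal_comp.mul (hasDerivAt_expSum v m i)).add
      ((hexp.const_mul Complex.I).const_mul (m i : ℂ)))
  refine pd_eq_of_hasDerivAt (h.congr_deriv ?_)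
  simp only [Function.update_eq_self, Pi.add_apply, Pi.mul_apply]
  push_cast
  linear_combination Complex.exp (logGround g m v) * m i *
    Complex.exp (Complex.I * (v i : ℂ)) * Complex.I_mul_I

end Derivatives

/-- The eigenvalue equation in terms of weights `m`, where `κ` is determined by
`1 - g m_i² = κ m_i`. -/
lemma weighted_eigenvalue_equation {n : ℕ} {v : Fin n → ℝ} {U : Set (Fin n → ℝ)} (hU : IsOpen U)
    (hreg : ∀ w ∈ U, Regular w) (hv : v ∈ U) (g κ : ℝ) (m : Fin n → ℝ) (hm : ∀ i, m i ≠ 0)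
    (hκ : ∀ i, 1 - g * m i ^ 2 = κ * m i) :
    -(∑ i, (1 / m i : ℂ) *
        pd i (pd i (fun w => (Real.exp (logGround g m w) : ℂ) * expSum m w)) v)
      + ((∑ i, ∑ j, g * m j * (g * m i * m j - 1) / 4 * halfCscSq v i j : ℝ) : ℂ)
        * (Real.exp (logGround g m v) * expSum m v)
    = ((κ + g * ∑ i, m i + g ^ 2 / 12 * ((∑ i, m i) ^ 3 - ∑ i, m i ^ 3) : ℝ) : ℂ)
        * (Real.exp (logGround g m v) * expSum m v) := by
  have hr := hreg v hv
  have hmC : ∀ i, (m i : ℂ) ≠ 0 := fun i => Complex.ofReal_ne_zero.2 (hm i)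
  have hterm : ∀ i, (1 / m i : ℂ) *
        pd i (pd i (fun w => (Real.exp (logGround g m w) : ℂ) * expSum m w)) v
      = Real.exp (logGround g m v) *
        ((g ^ 2 / 4 * (m i * (∑ j, m j * halfCot v i j) ^ 2)
            - ∑ j, g * m j / 4 * halfCscSq v i j : ℝ) * expSum m v
        + (Complex.I * g * ∑ j, (m i * m j * halfCot v i j : ℂ)
            * Complex.exp (Complex.I * (v i : ℂ)))
        - Complex.exp (Complex.I * (v i : ℂ))) := by
    intro i
    rw [pd_pd_ground_mul_expSum hU hreg hv g m i]
    have e1 : (gradLogGround g m i v ^ 2 - g * m i / 4 * ∑ j, m j * halfCscSq v i j : ℝ)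
        = m i * (g ^ 2 / 4 * (m i * (∑ j, m j * halfCot v i j) ^ 2)
            - ∑ j, g * m j / 4 * halfCscSq v i j) := by
      have : ∑ j, g * m j / 4 * halfCscSq v i j = g / 4 * ∑ j, m j * halfCscSq v i j := by
        rw [mul_sum]; exact sum_congr rfl fun j _ => by ring
      rw [this, gradLogGround]; ring
    have e2 : ∑ j, (m i * m j * halfCot v i j : ℂ) * Complex.exp (Complex.I * (v i : ℂ))
        = m i * Complex.exp (Complex.I * (v i : ℂ)) * ((∑ j, m j * halfCot v i j : ℝ) : ℂ) := by
      push_cast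
      rw [mul_sum]; exact sum_congr rfl fun j _ => by ring
    rw [e1, e2, gradLogGround]
    have := hmC i
    push_cast
    field_simp
    ring
  have hcross := sum_halfCot_mul_exp hr m
  have hκ' : ∑ i, Complex.exp (Complex.I * (v i : ℂ))
      = κ * expSum m v + g * ∑ i, (m i : ℂ) ^ 2 * Complex.exp (Complex.I * (v i : ℂ)) := by
    rw [expSum, mul_sum, mul_sum, ← sum_add_distrib]
    refine sum_congr rfl fun i _ => ?_
    have : (1 - g * m i ^ 2 : ℂ) = κ * m i := by exact_mod_cast hκ i
    linear_combination Complex.exp (Complex.I * (v i : ℂ)) * this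
  have hsq := sum_halfCot_mul_halfCot hr m
  have hreal : -(∑ i, (g ^ 2 / 4 * (m i * (∑ j, m j * halfCot v i j) ^ 2)
            - ∑ j, g * m j / 4 * halfCscSq v i j))
        + ∑ i, ∑ j, g * m j * (g * m i * m j - 1) / 4 * halfCscSq v i j
      = g ^ 2 / 12 * ((∑ i, m i) ^ 3 - ∑ i, m i ^ 3) := by
    have : ∑ i, ∑ j, g * m j * (g * m i * m j - 1) / 4 * halfCscSq v i j
        = g ^ 2 / 4 * ∑ i, ∑ j, m i * m j ^ 2 * halfCscSq v i j
          - ∑ i, ∑ j, g * m j / 4 * halfCscSq v i j := by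
      simp only [mul_sum, ← sum_sub_distrib]
      exact sum_congr rfl fun i _ => sum_congr rfl fun j _ => by ring
    rw [this, sum_sub_distrib, ← mul_sum]
    linear_combination (-g ^ 2 / 12) * hsq
  have hrealC := congrArg (fun r : ℝ => (r : ℂ)) hreal
  simp only [Complex.ofReal_add, Complex.ofReal_neg] at hrealC
  simp only [hterm]
  rw [← mul_sum, sum_sub_distrib, sum_add_distrib, ← sum_mul, ← mul_sum, hcross, hκ',
    ← Complex.ofReal_sum]
  rw [Complex.ofReal_add, ← hrealC]
  push_cast
  linear_combination (-Complex.exp (logGround g m v) * g *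
    ((∑ i, (m i : ℂ)) * expSum m v - ∑ i, (m i : ℂ) ^ 2 * Complex.exp (Complex.I * (v i : ℂ))))
      * Complex.I_mul_I

lemma sum_sum_eq_two_mul_sum_lt {n : ℕ} {f : Fin n → Fin n → ℝ} (hsymm : ∀ i j, f i j = f j i)
    (hdiag : ∀ i, f i i = 0) :
    ∑ i, ∑ j, f i j = 2 * ∑ i, ∑ j, if i < j then f i j else 0 := by
  have hsplit : ∀ i j, f i j = (if i < j then f i j else 0) + (if j < i then f j i else 0) := by
    intro i j
    rcases lt_trichotomy i j with h | h | h
    · simp [h, h.not_gt]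
    · subst h; simp [hdiag]
    · simp [h, h.not_gt, hsymm i j]
  calc _ = ∑ i, ∑ j, ((if i < j then f i j else 0) + (if j < i then f j i else 0)) :=
        sum_congr rfl fun i _ => sum_congr rfl fun j _ => hsplit i j
    _ = _ := by
      simp only [sum_add_distrib]
      rw [sum_comm (f := fun i j => if j < i then f j i else 0)]
      ring

/-- The weights `1` for the `x`-variables and `-1/g` for the `y`-variables. -/
noncomputable def superWeight (N M : ℕ) (g : ℝ) : Fin (N + M) → ℝ :=
  Fin.append (fun _ => 1) (fun _ => -1 / g)

section Region

variable {N M : ℕ} {g : ℝ}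

@[simp] lemma superWeight_castAdd (j : Fin N) : superWeight N M g (Fin.castAdd M j) = 1 := by
  simp [superWeight]

@[simp] lemma superWeight_natAdd (k : Fin M) : superWeight N M g (Fin.natAdd N k) = -1 / g := by
  simp [superWeight]

lemma isOpen_regionU (N M : ℕ) : IsOpen (regionU N M) := by
  have h : regionU N M = (⋂ i, {u | u i ∈ Set.Ioo (-Real.pi) Real.pi})
      ∩ ⋂ i, ⋂ j, ⋂ (_ : i < j), {u | u j < u i} := by
    ext u
    simp [regionU, StrictAnti]
  rw [h]
  refine (isOpen_iInter_of_finite fun i => isOpen_Ioo.preimage (continuous_apply i)).inter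
    (isOpen_iInter_of_finite fun i => isOpen_iInter_of_finite fun j =>
      isOpen_iInter_of_finite fun _ => isOpen_lt (continuous_apply j) (continuous_apply i))

lemma sin_half_pos_of_mem_regionU {u : Fin (N + M) → ℝ} (hu : u ∈ regionU N M)
    {i j : Fin (N + M)} (hij : i < j) : 0 < Real.sin ((u i - u j) / 2) := by
  have h := hu.2 hij
  have hi := hu.1 i
  have hj := hu.1 j
  simp only [Set.mem_Ioo] at hi hj
  exact Real.sin_pos_of_pos_of_lt_pi (by linarith) (by linarith)

lemma regular_of_mem_regionU {u : Fin (N + M) → ℝ} (hu : u ∈ regionU N M) : Regular u := by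
  intro i j hij
  rcases lt_or_gt_of_ne hij with h | h
  · exact (sin_half_pos_of_mem_regionU hu h).ne'
  · rw [sin_half_sub_comm]
    exact neg_ne_zero.2 (sin_half_pos_of_mem_regionU hu h).ne'

lemma log_sin_half_comm {n : ℕ} (u : Fin n → ℝ) (i j : Fin n) :
    Real.log (Real.sin ((u i - u j) / 2)) = Real.log (Real.sin ((u j - u i) / 2)) := by
  rw [sin_half_sub_comm, Real.log_neg_eq_log]

lemma prod_lt_eq_exp_sum_log {n : ℕ} {f : Fin n → Fin n → ℝ} (hf : ∀ i j, i < j → 0 < f i j) :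
    (∏ i, ∏ j, if i < j then f i j else 1)
      = Real.exp (∑ i, ∑ j, if i < j then Real.log (f i j) else 0) := by
  simp only [Real.exp_sum]
  refine prod_congr rfl fun i _ => prod_congr rfl fun j _ => ?_
  split_ifs with h
  · exact (Real.exp_log (hf i j h)).symm
  · simp

lemma Psi0_eq_exp_logGround (hg : 0 < g) {u : Fin (N + M) → ℝ} (hu : u ∈ regionU N M) :
    Psi0 N M g u = Real.exp (logGround g (superWeight N M g) u) := by
  have hlt : ∀ (j : Fin N) (k : Fin M), Fin.castAdd M j < Fin.natAdd N k := fun j k => by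
    rw [Fin.lt_def, Fin.val_castAdd, Fin.val_natAdd]; omega
  have hxy : (∏ j : Fin N, ∏ k : Fin M,
        Real.sin ((u (Fin.castAdd M j) - u (Fin.natAdd N k)) / 2))
      = Real.exp (∑ j : Fin N, ∑ k : Fin M,
        Real.log (Real.sin ((u (Fin.castAdd M j) - u (Fin.natAdd N k)) / 2))) := by
    simp only [Real.exp_sum]
    exact prod_congr rfl fun j _ => prod_congr rfl fun k _ =>
      (Real.exp_log (sin_half_pos_of_mem_regionU hu (hlt j k))).symm
  rw [Psi0, hxy,
    prod_lt_eq_exp_sum_log (f := fun j j' : Fin N =>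
      Real.sin ((u (Fin.castAdd M j) - u (Fin.castAdd M j')) / 2))
      fun j j' h => sin_half_pos_of_mem_regionU hu (Fin.lt_def.2 h),
    prod_lt_eq_exp_sum_log (f := fun k k' : Fin M =>
      Real.sin ((u (Fin.natAdd N k) - u (Fin.natAdd N k')) / 2))
      fun k k' h => sin_half_pos_of_mem_regionU hu (Fin.lt_def.2 (Nat.add_lt_add_left h N)),
    ← Real.exp_mul, ← Real.exp_mul, ← Real.exp_add, ← Real.exp_sub]
  congr 1
  have hxx := sum_sum_eq_two_mul_sum_lt (f := fun j j' : Fin N =>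
      Real.log (Real.sin ((u (Fin.castAdd M j) - u (Fin.castAdd M j')) / 2)))
      (fun _ _ => log_sin_half_comm u _ _) (by simp)
  have hyy := sum_sum_eq_two_mul_sum_lt (f := fun k k' : Fin M =>
      Real.log (Real.sin ((u (Fin.natAdd N k) - u (Fin.natAdd N k')) / 2)))
      (fun _ _ => log_sin_half_comm u _ _) (by simp)
  have hyx : ∑ k : Fin M, ∑ j : Fin N,
        Real.log (Real.sin ((u (Fin.natAdd N k) - u (Fin.castAdd M j)) / 2))
      = ∑ j : Fin N, ∑ k : Fin M,
        Real.log (Real.sin ((u (Fin.castAdd M j) - u (Fin.natAdd N k)) / 2)) := by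
    rw [sum_comm]
    exact sum_congr rfl fun _ _ => sum_congr rfl fun _ _ => log_sin_half_comm u _ _
  simp only [logGround, Fin.sum_univ_add, superWeight_castAdd, superWeight_natAdd, sum_add_distrib,
    ← mul_sum]
  rw [hxx, hyy, hyx]
  field_simp
  ring

lemma potential_eq_sum_halfCscSq (hg : 0 < g) (u : Fin (N + M) → ℝ) :
    ((∑ j : Fin N, ∑ j' : Fin N, if j < j' then
            g * (g - 1) / (2 * Real.sin ((u (Fin.castAdd M j) - u (Fin.castAdd M j')) / 2) ^ 2)
          else 0)
        + (∑ k : Fin M, ∑ k' : Fin M, if k < k' then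
            ((g - 1) / g) / (2 * Real.sin ((u (Fin.natAdd N k) - u (Fin.natAdd N k')) / 2) ^ 2)
          else 0)
        + ∑ j : Fin N, ∑ k : Fin M,
            (1 - g) / (2 * Real.sin ((u (Fin.castAdd M j) - u (Fin.natAdd N k)) / 2) ^ 2))
      = ∑ i, ∑ j, g * superWeight N M g j * (g * superWeight N M g i * superWeight N M g j - 1) / 4
          * halfCscSq u i j := by
  have hdiv : ∀ (c : ℝ) (i j : Fin (N + M)),
      c / (2 * Real.sin ((u i - u j) / 2) ^ 2) = c / 2 * halfCscSq u i j := by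
    intro c i j
    rw [halfCscSq, div_mul_div_comm, mul_one]
  have hxx := sum_sum_eq_two_mul_sum_lt (f := fun j j' : Fin N =>
      g * (g - 1) / 2 * halfCscSq u (Fin.castAdd M j) (Fin.castAdd M j'))
      (fun _ _ => by rw [halfCscSq_comm]) (by simp [halfCscSq_self])
  have hyy := sum_sum_eq_two_mul_sum_lt (f := fun k k' : Fin M =>
      (g - 1) / g / 2 * halfCscSq u (Fin.natAdd N k) (Fin.natAdd N k'))
      (fun _ _ => by rw [halfCscSq_comm]) (by simp [halfCscSq_self])
  have hyx : ∑ k : Fin M, ∑ j : Fin N, halfCscSq u (Fin.natAdd N k) (Fin.castAdd M j)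
      = ∑ j : Fin N, ∑ k : Fin M, halfCscSq u (Fin.castAdd M j) (Fin.natAdd N k) := by
    rw [sum_comm]
    exact sum_congr rfl fun _ _ => sum_congr rfl fun _ _ => halfCscSq_comm u _ _
  simp only [hdiv, Fin.sum_univ_add, superWeight_castAdd, superWeight_natAdd, sum_add_distrib]
  rw [← mul_right_inj' (two_ne_zero (α := ℝ)), mul_add, mul_add, ← hxx, ← hyy]
  simp only [← mul_sum]
  rw [hyx]
  field_simp
  ring

lemma expSum_superWeight (v : Fin (N + M) → ℝ) :
    (∑ j : Fin N, Complex.exp (Complex.I * (v (Fin.castAdd M j) : ℂ)))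
          - (1 / (g : ℂ)) * ∑ k : Fin M, Complex.exp (Complex.I * (v (Fin.natAdd N k) : ℂ))
      = expSum (superWeight N M g) v := by
  simp only [expSum, Fin.sum_univ_add, superWeight_castAdd, superWeight_natAdd, ← mul_sum]
  push_cast
  ring

end Region

/-- On `U`, `F = Ψ₀ · (∑_j e^{ix_j} − (1/g) ∑_k e^{iy_k})` is a pointwise eigenfunction of
the deformed Calogero–Sutherland operator with eigenvalue
`1 + g(N−1) − M + (g²/12)[(N − M/g)³ − (N − M/g³)]`. -/
theorem first_excited_eigenfunction (N M : ℕ) (g : ℝ) (hg : 0 < g)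
    (u : Fin (N + M) → ℝ) (hu : u ∈ regionU N M) :
    HNM N M g (fun v => (Psi0 N M g v : ℂ) *
        ((∑ j : Fin N, Complex.exp (Complex.I * (v (Fin.castAdd M j) : ℂ)))
          - (1 / (g : ℂ)) * ∑ k : Fin M, Complex.exp (Complex.I * (v (Fin.natAdd N k) : ℂ)))) u
      = ((1 + g * ((N : ℝ) - 1) - (M : ℝ)
            + g ^ 2 / 12 * (((N : ℝ) - M / g) ^ 3 - ((N : ℝ) - M / g ^ 3)) : ℝ) : ℂ)
          * ((Psi0 N M g u : ℂ) *
            ((∑ j : Fin N, Complex.exp (Complex.I * (u (Fin.castAdd M j) : ℂ)))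
              - (1 / (g : ℂ)) * ∑ k : Fin M, Complex.exp (Complex.I * (u (Fin.natAdd N k) : ℂ)))) := by
  have hg' : g ≠ 0 := hg.ne'
  have hgC : (g : ℂ) ≠ 0 := Complex.ofReal_ne_zero.2 hg'
  have hU := isOpen_regionU N M
  have hF : ∀ w ∈ regionU N M, (Psi0 N M g w : ℂ) * expSum (superWeight N M g) w
      = (Real.exp (logGround g (superWeight N M g) w) : ℂ) * expSum (superWeight N M g) w :=
    fun w hw => by rw [Psi0_eq_exp_logGround hg hw]
  have hpd : ∀ i, pd i (pd i fun w => (Psi0 N M g w : ℂ) * expSum (superWeight N M g) w) u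
      = pd i (pd i fun w => (Real.exp (logGround g (superWeight N M g) w) : ℂ)
        * expSum (superWeight N M g) w) u :=
    fun i => pd_congr_of_isOpen hU (fun w hw => pd_congr_of_isOpen hU hF hw i) hu i
  have hm : ∀ i, superWeight N M g i ≠ 0 := fun i => by
    refine Fin.addCases (fun j => ?_) (fun k => ?_) i <;> simp [hg']
  have hκ : ∀ i, 1 - g * superWeight N M g i ^ 2 = (1 - g) * superWeight N M g i := fun i => by
    refine Fin.addCases (fun j => ?_) (fun k => ?_) i
    · simp
    · simp only [superWeight_natAdd]
      field_simp
      ring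
  have main := weighted_eigenvalue_equation hU (fun w hw => regular_of_mem_regionU hw) hu g (1 - g)
    (superWeight N M g) hm hκ
  simp only [HNM, expSum_superWeight, potential_eq_sum_halfCscSq hg]
  simp only [hpd, hF u hu]
  have hsum : ∑ i, superWeight N M g i = N - M / g := by
    simp [Fin.sum_univ_add]; ring
  have hsum₃ : ∑ i, superWeight N M g i ^ 3 = N - M / g ^ 3 := by
    simp [Fin.sum_univ_add]; field_simp; ring
  rw [hsum, hsum₃, Fin.sum_univ_add] at main
  simp only [superWeight_castAdd, superWeight_natAdd, ← mul_sum] at main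
  convert main using 2
  · push_cast
    field_simp
    ring
  · congr 1
    field_simp
    ring
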